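/- Let Λ be a symbol with odd defect, rank(Λ) = n and Υ(Λ) = [λ; μ], set n' = n − μ_1 + (def(Λ) + 1)/2, and let Λ' be a symbol with Υ(Λ') = [μ²; λ] and def(Λ') = −def(Λ) − 1 (so rank(Λ') = n'). Then every symbol Λ'' with rank(Λ'') = n and (Λ'', Λ') ∈ B^−_{n,n'} satisfies either Υ(Λ'') = [λ; μ] (so Λ'' is equivalent to Λ) or (Υ(Λ'')_*)_1 > μ_1. -/

import Mathlib

namespace GGP

/-- A *symbol* `Λ = (A; B)`: an ordered pair of finite sets of natural numbers. -/
structure Symbol where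
  A : Finset ℕ
  B : Finset ℕ

namespace Symbol

/-- The rank of a symbol:
`rank(Λ) = Σ_{a∈A} a + Σ_{b∈B} b − ⌊((|A|+|B|−1)/2)²⌋ = Σ + Σ − ⌊(|A|+|B|−1)²/4⌋`. -/
def rank (Λ : Symbol) : ℤ :=
  (∑ a ∈ Λ.A, (a : ℤ)) + (∑ b ∈ Λ.B, (b : ℤ))
    - ((Λ.A.card : ℤ) + (Λ.B.card : ℤ) - 1) ^ 2 / 4

/-- The defect of a symbol: `def(Λ) = |A| − |B| ∈ ℤ`. -/
def defect (Λ : Symbol) : ℤ := (Λ.A.card : ℤ) - (Λ.B.card : ℤ)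

/-- The shift of a symbol: `(a_1,…,a_m; b_1,…,b_l) ↦ (a_1+1,…,a_m+1,0; b_1+1,…,b_l+1,0)`. -/
def shift (Λ : Symbol) : Symbol :=
  ⟨insert 0 (Λ.A.image (· + 1)), insert 0 (Λ.B.image (· + 1))⟩

/-- Equivalence of symbols: one is obtained from the other by finitely many shifts. -/
def Equiv (Λ M : Symbol) : Prop :=
  ∃ k l : ℕ, shift^[k] Λ = shift^[l] M

end Symbol

/-- The partition associated to a finite set `A = {a_1 > … > a_m}` of naturals:
the function sending the index `i` (0-based, so `i` stands for the (i+1)-st part)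
to `λ_{i+1} = a_{i+1} − (m − (i+1))`, with parts beyond the length equal to `0`. -/
def upsFun (A : Finset ℕ) : ℕ → ℕ := fun i =>
  if h : i < A.card then
    (A.sort (· ≤ ·))[A.card - 1 - i]'(by rw [Finset.length_sort]; omega)
      - (A.card - 1 - i)
  else 0

/-- `|λ|`: the sum of the parts of a partition (given as a function). -/
noncomputable def psize (f : ℕ → ℕ) : ℕ := ∑ᶠ i, f i

/-- The transpose of a partition: `(ᵗλ)_{i+1} = #{ j : λ_{j+1} ≥ i+1 }` (0-based index `i`). -/
noncomputable def transposeFun (f : ℕ → ℕ) : ℕ → ℕ := fun i => Set.ncard {j | i + 1 ≤ f j}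

/-- `λ ≼ μ` : `μ_i − 1 ≤ λ_i ≤ μ_i` for every `i`. -/
def Prec (f g : ℕ → ℕ) : Prop := ∀ i, g i - 1 ≤ f i ∧ f i ≤ g i

/-- `λ²`: the partition obtained from `λ` by deleting one copy of its largest part. -/
def tailPart (f : ℕ → ℕ) : ℕ → ℕ := fun i => f (i + 1)

/-- A function `ℕ → ℕ` represents a partition iff it is antitone and eventually zero. -/
def IsPartitionFun (f : ℕ → ℕ) : Prop :=
  Antitone f ∧ ∃ N, ∀ i, N ≤ i → f i = 0

/-- `(Λ, Λ') ∈ B^+_{n,n'}`. -/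
def BPlus (n n' : ℕ) (Λ Λ' : Symbol) : Prop :=
  Λ.rank = (n : ℤ) ∧ Λ'.rank = (n' : ℤ) ∧
    Prec (transposeFun (upsFun Λ'.B)) (transposeFun (upsFun Λ.A)) ∧
    Prec (transposeFun (upsFun Λ.B)) (transposeFun (upsFun Λ'.A)) ∧
    Λ'.defect = -Λ.defect + 1

/-- `(Λ, Λ') ∈ B^−_{n,n'}`. -/
def BMinus (n n' : ℕ) (Λ Λ' : Symbol) : Prop :=
  Λ.rank = (n : ℤ) ∧ Λ'.rank = (n' : ℤ) ∧
    Prec (transposeFun (upsFun Λ'.A)) (transposeFun (upsFun Λ.B)) ∧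
    Prec (transposeFun (upsFun Λ.A)) (transposeFun (upsFun Λ'.B)) ∧
    Λ'.defect = -Λ.defect - 1

/-- A symbol is reduced if not both rows contain `0`. -/
def Reduced (Λ : Symbol) : Prop := ¬ (0 ∈ Λ.A ∧ 0 ∈ Λ.B)


theorem le_apply_of_strictMono_fin {m : ℕ} {f : Fin m → ℕ} (hf : StrictMono f) (i : Fin m) :
    (i : ℕ) ≤ f i := by
  obtain ⟨i, hi⟩ := i
  induction i with
  | zero => exact Nat.zero_le _
  | succ i ih =>
    exact (ih (Nat.lt_of_succ_lt hi)).trans_lt (hf (Fin.mk_lt_mk.mpr (Nat.lt_succ_self i)))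

/-- The defining relation between the parts of `upsFun A` and the increasing enumeration of `A`. -/
theorem upsFun_add_eq_orderEmbOfFin {A : Finset ℕ} {m i : ℕ} (hm : A.card = m) (hi : i < m) :
    upsFun A i + (m - 1 - i) = A.orderEmbOfFin hm ⟨m - 1 - i, by omega⟩ := by
  subst hm
  have hle := le_apply_of_strictMono_fin (A.orderEmbOfFin rfl).strictMono
    ⟨A.card - 1 - i, by omega⟩
  rw [Finset.orderEmbOfFin_apply] at hle ⊢
  simp only [upsFun, dif_pos hi]
  exact Nat.sub_add_cancel hle

theorem upsFun_eq_zero {A : Finset ℕ} {i : ℕ} (hi : A.card ≤ i) : upsFun A i = 0 :=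
  dif_neg (by omega)

theorem upsFun_antitone (A : Finset ℕ) : Antitone (upsFun A) := by
  refine antitone_nat_of_succ_le fun i => ?_
  by_cases hi : i + 1 < A.card
  · have h₁ := upsFun_add_eq_orderEmbOfFin rfl hi
    have h₂ := upsFun_add_eq_orderEmbOfFin rfl (Nat.lt_of_succ_lt hi)
    have h₃ : A.orderEmbOfFin rfl ⟨A.card - 1 - (i + 1), by omega⟩
        < A.orderEmbOfFin rfl ⟨A.card - 1 - i, by omega⟩ :=
      (A.orderEmbOfFin rfl).strictMono (by simp only [Fin.mk_lt_mk]; omega)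
    omega
  · simp [upsFun_eq_zero (not_lt.mp hi)]

theorem isPartitionFun_upsFun (A : Finset ℕ) : IsPartitionFun (upsFun A) :=
  ⟨upsFun_antitone A, A.card, fun _ => upsFun_eq_zero⟩

theorem eq_of_upsFun_eq {A B : Finset ℕ} (hc : A.card = B.card) (h : upsFun A = upsFun B) :
    A = B := by
  have he : A.orderEmbOfFin hc = B.orderEmbOfFin rfl := by
    ext ⟨j, hj⟩
    have hi : B.card - 1 - j < B.card := by omega
    have h₁ := upsFun_add_eq_orderEmbOfFin hc hi
    have h₂ := upsFun_add_eq_orderEmbOfFin rfl hi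
    have hj' : B.card - 1 - (B.card - 1 - j) = j := by omega
    simp only [hj'] at h₁ h₂
    rw [← h₁, ← h₂, h]
  rw [← Finset.coe_inj, ← Finset.range_orderEmbOfFin A hc, he, Finset.range_orderEmbOfFin]

/-- Twice the sum of a finite set in terms of the size of its partition. -/
theorem two_mul_sum_eq (A : Finset ℕ) {N : ℕ} (hN : A.card ≤ N) :
    2 * ∑ a ∈ A, (a : ℤ)
      = 2 * ∑ i ∈ Finset.range N, (upsFun A i : ℤ) + (A.card : ℤ) * (A.card - 1) := by
  have hsum : ∑ a ∈ A, a = ∑ j : Fin A.card, A.orderEmbOfFin rfl j := by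
    conv_lhs => rw [← Finset.map_orderEmbOfFin_univ A rfl, Finset.sum_map]
    rfl
  have hrev : ∑ j : Fin A.card, A.orderEmbOfFin rfl j
      = ∑ i : Fin A.card, (upsFun A i + (A.card - 1 - i)) := by
    rw [← Equiv.sum_comp Fin.revPerm]
    refine Finset.sum_congr rfl fun i _ => ?_
    rw [upsFun_add_eq_orderEmbOfFin rfl i.2]
    congr 1
    ext
    simp only [Fin.revPerm_apply, Fin.val_rev]
    omega
  rw [hrev, Fin.sum_univ_eq_sum_range (fun i => upsFun A i + (A.card - 1 - i)),
    Finset.sum_add_distrib, Finset.sum_range_reflect (fun i => i)] at hsum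
  have hext : ∑ i ∈ Finset.range A.card, upsFun A i = ∑ i ∈ Finset.range N, upsFun A i :=
    Finset.sum_subset (Finset.range_mono hN) fun i _ hi =>
      upsFun_eq_zero (by simpa using hi)
  have hid := Finset.sum_range_id_mul_two A.card
  have hcast : ((A.card * (A.card - 1) : ℕ) : ℤ) = (A.card : ℤ) * (A.card - 1) := by
    rcases A.card with _ | m <;> simp
  rw [← hcast, ← Nat.cast_sum A (fun a => a)]
  exact_mod_cast (by rw [← hext]; omega :
    2 * ∑ a ∈ A, a = 2 * ∑ i ∈ Finset.range N, upsFun A i + A.card * (A.card - 1))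

/-- Shifting one row of a symbol adds one entry to it. -/
theorem card_insert_zero_image_succ (A : Finset ℕ) :
    (insert 0 (A.image (· + 1))).card = A.card + 1 := by
  rw [Finset.card_insert_of_notMem (by simp),
    Finset.card_image_of_injective _ (add_left_injective 1)]

theorem upsFun_insert_zero_image_succ (A : Finset ℕ) :
    upsFun (insert 0 (A.image (· + 1))) = upsFun A := by
  have hcard := card_insert_zero_image_succ A
  set f : Fin (A.card + 1) → ℕ := Fin.cons 0 fun j => A.orderEmbOfFin rfl j + 1 with hf
  have hmem : ∀ x, f x ∈ insert 0 (A.image (· + 1)) := by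
    intro x
    refine Fin.cases ?_ (fun j => ?_) x <;> simp [hf]
  have hmono : StrictMono f := by
    refine Fin.strictMono_iff_lt_succ.mpr fun i => ?_
    rcases i with ⟨_ | i, hi⟩
    · exact Nat.succ_pos _
    · have hc : (⟨i + 1, hi⟩ : Fin A.card).castSucc = (⟨i, by omega⟩ : Fin A.card).succ := rfl
      rw [hc]
      simp only [hf, Fin.cons_succ, add_lt_add_iff_right, OrderEmbedding.lt_iff_lt, Fin.mk_lt_mk]
      omega
  have huniq := Finset.orderEmbOfFin_unique hcard hmem hmono
  funext i
  rcases lt_trichotomy i A.card with hi | rfl | hi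
  · have h₁ := upsFun_add_eq_orderEmbOfFin hcard (Nat.lt_succ_of_lt hi)
    have h₂ := upsFun_add_eq_orderEmbOfFin rfl hi
    have hx : (⟨A.card + 1 - 1 - i, by omega⟩ : Fin (A.card + 1))
        = (⟨A.card - 1 - i, by omega⟩ : Fin A.card).succ := by
      ext; simp only [Fin.val_succ]; omega
    rw [← huniq, hx] at h₁
    simp only [hf, Fin.cons_succ] at h₁
    omega
  · have h₁ := upsFun_add_eq_orderEmbOfFin hcard (Nat.lt_succ_self A.card)
    have hx : (⟨A.card + 1 - 1 - A.card, by omega⟩ : Fin (A.card + 1)) = 0 := by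
      ext; simp
    rw [← huniq, hx] at h₁
    simp only [hf, Fin.cons_zero] at h₁
    rw [upsFun_eq_zero le_rfl]
    omega
  · rw [upsFun_eq_zero hi.le, upsFun_eq_zero (by omega)]

theorem Symbol.shift_iterate_spec (Λ : Symbol) (k : ℕ) :
    (shift^[k] Λ).A.card = Λ.A.card + k ∧ (shift^[k] Λ).B.card = Λ.B.card + k ∧
      upsFun (shift^[k] Λ).A = upsFun Λ.A ∧ upsFun (shift^[k] Λ).B = upsFun Λ.B := by
  induction k with
  | zero => simp
  | succ k ih =>
    obtain ⟨hA, hB, hfA, hfB⟩ := ih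
    rw [Function.iterate_succ_apply']
    simp only [shift, card_insert_zero_image_succ, upsFun_insert_zero_image_succ]
    exact ⟨by omega, by omega, hfA, hfB⟩

/-- Symbols with the same defect and the same bipartition are equivalent. -/
theorem Symbol.equiv_of_upsFun_eq {Λ M : Symbol} (hd : Λ.defect = M.defect)
    (hA : upsFun Λ.A = upsFun M.A) (hB : upsFun Λ.B = upsFun M.B) : Equiv Λ M := by
  refine ⟨M.A.card, Λ.A.card, ?_⟩
  obtain ⟨h₁, h₂, h₃, h₄⟩ := shift_iterate_spec Λ M.A.card
  obtain ⟨k₁, k₂, k₃, k₄⟩ := shift_iterate_spec M Λ.A.card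
  unfold defect at hd
  have e₁ := eq_of_upsFun_eq (by omega) (h₃.trans (hA.trans k₃.symm))
  have e₂ := eq_of_upsFun_eq (by omega) (h₄.trans (hB.trans k₄.symm))
  exact congrArg₂ Symbol.mk e₁ e₂

/-- The rank of a symbol of odd defect in terms of its bipartition and its defect. -/
theorem Symbol.four_mul_rank_of_odd {Λ : Symbol} (hd : Odd Λ.defect) {N : ℕ}
    (hA : Λ.A.card ≤ N) (hB : Λ.B.card ≤ N) :
    4 * Λ.rank = 4 * (∑ i ∈ Finset.range N, (upsFun Λ.A i : ℤ)
      + ∑ i ∈ Finset.range N, (upsFun Λ.B i : ℤ)) + (Λ.defect ^ 2 - 1) := by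
  have h₁ := two_mul_sum_eq Λ.A hA
  have h₂ := two_mul_sum_eq Λ.B hB
  obtain ⟨t, ht⟩ := hd
  unfold rank
  unfold defect at ht ⊢
  have hm : (Λ.A.card : ℤ) = Λ.B.card + 2 * t + 1 := by linarith
  have hs : ((Λ.A.card : ℤ) + Λ.B.card - 1) ^ 2 / 4 = (Λ.B.card + t) ^ 2 :=
    Int.ediv_eq_of_eq_mul_right (by norm_num) (by rw [hm]; ring)
  rw [hs]
  rw [hm] at h₁ ⊢
  linear_combination 2 * h₁ + 2 * h₂

/-- The rank of a symbol of even defect in terms of its bipartition and its defect. -/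
theorem Symbol.four_mul_rank_of_even {Λ : Symbol} (hd : Even Λ.defect) {N : ℕ}
    (hA : Λ.A.card ≤ N) (hB : Λ.B.card ≤ N) :
    4 * Λ.rank = 4 * (∑ i ∈ Finset.range N, (upsFun Λ.A i : ℤ)
      + ∑ i ∈ Finset.range N, (upsFun Λ.B i : ℤ)) + Λ.defect ^ 2 := by
  have h₁ := two_mul_sum_eq Λ.A hA
  have h₂ := two_mul_sum_eq Λ.B hB
  obtain ⟨t, ht⟩ := hd
  unfold rank
  unfold defect at ht ⊢
  have hm : (Λ.A.card : ℤ) = Λ.B.card + 2 * t := by linarith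
  have hs : ((Λ.A.card : ℤ) + Λ.B.card - 1) ^ 2 / 4
      = (Λ.B.card + t) ^ 2 - (Λ.B.card + t) := by
    have hsq : ((Λ.A.card : ℤ) + Λ.B.card - 1) ^ 2
        = 4 * ((Λ.B.card + t) ^ 2 - (Λ.B.card + t)) + 1 := by rw [hm]; ring
    omega
  rw [hs]
  rw [hm] at h₁ ⊢
  linear_combination 2 * h₁ + 2 * h₂

/-- A column of length more than `j` reaches the row `j`, and conversely. -/
theorem lt_transposeFun_iff {f : ℕ → ℕ} (hf : IsPartitionFun f) {j k : ℕ} :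
    j < transposeFun f k ↔ k + 1 ≤ f j := by
  obtain ⟨hanti, N, hN⟩ := hf
  constructor
  · intro h
    by_contra! hlt
    have hsub : {i | k + 1 ≤ f i} ⊆ (Finset.range j : Set ℕ) := fun i hi => by
      by_contra! hij
      have := hanti (show j ≤ i by simpa using hij)
      simp only [Set.mem_ofPred_eq] at hi
      omega
    have := Set.ncard_le_ncard hsub (Finset.finite_toSet _)
    rw [Set.ncard_coe_finset, Finset.card_range] at this
    exact absurd h (not_lt.mpr this)
  · intro h
    have hfin : {i | k + 1 ≤ f i}.Finite := (Finset.range N).finite_toSet.subset fun i hi => by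
      by_contra! hiN
      have := hN i (by simpa using hiN)
      simp only [Set.mem_ofPred_eq] at hi
      omega
    have hsub : (Finset.range (j + 1) : Set ℕ) ⊆ {i | k + 1 ≤ f i} := fun i hi =>
      h.trans (hanti (by simpa [Nat.lt_succ_iff] using hi))
    have := Set.ncard_le_ncard hsub hfin
    rwa [Set.ncard_coe_finset, Finset.card_range] at this

/-- If `ᵗf ≼ ᵗg` then `g / f` is a horizontal strip. -/
theorem Prec.interlace {f g : ℕ → ℕ} (hf : IsPartitionFun f) (hg : IsPartitionFun g)
    (h : Prec (transposeFun f) (transposeFun g)) (j : ℕ) : f j ≤ g j ∧ g (j + 1) ≤ f j := by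
  constructor
  · rcases hk : f j with _ | k
    · exact Nat.zero_le _
    · exact (lt_transposeFun_iff hg).mp
        (((lt_transposeFun_iff hf).mpr hk.ge).trans_le (h k).2)
  · rcases hk : g (j + 1) with _ | k
    · exact Nat.zero_le _
    · have h₁ := (lt_transposeFun_iff hg).mpr hk.ge
      have h₂ := (h k).1
      exact (lt_transposeFun_iff hf).mp (by omega)

/-- Let `Λ` have odd defect, rank `n`, `Υ(Λ) = [λ; μ]`, let
`n' = n − μ_1 + (def(Λ)+1)/2`, and let `Λ'` satisfy `Υ(Λ') = [μ²; λ]` and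
`def(Λ') = −def(Λ)−1` (so `rank(Λ') = n'`).  Then every symbol `Λ''` of rank `n`
with `(Λ'', Λ') ∈ B^−_{n,n'}` satisfies either `Υ(Λ'') = [λ; μ]` (and `Λ''` is
equivalent to `Λ`) or `(Υ(Λ'')_*)_1 > μ_1`. -/
theorem statement13 (Λ Λ' : Symbol) (hodd : Odd Λ.defect) (n n' : ℕ)
    (hn : Λ.rank = (n : ℤ))
    (hn' : (n' : ℤ) = (n : ℤ) - (upsFun Λ.B 0 : ℤ) + (Λ.defect + 1) / 2)
    (h1 : upsFun Λ'.A = tailPart (upsFun Λ.B)) (h2 : upsFun Λ'.B = upsFun Λ.A)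
    (h3 : Λ'.defect = -Λ.defect - 1) :
    Λ'.rank = (n' : ℤ) ∧
    ∀ Λ'' : Symbol, BMinus n n' Λ'' Λ' →
      (upsFun Λ''.A = upsFun Λ.A ∧ upsFun Λ''.B = upsFun Λ.B ∧
        Symbol.Equiv Λ'' Λ) ∨
      upsFun Λ.B 0 < upsFun Λ''.B 0 := by
  have hd' : Even Λ'.defect := by
    rw [h3]
    obtain ⟨t, ht⟩ := hodd
    exact ⟨-t - 1, by rw [ht]; ring⟩
  constructor
  · obtain ⟨N, hN⟩ : ∃ N, N = Λ.A.card + Λ.B.card + Λ'.A.card + Λ'.B.card := ⟨_, rfl⟩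
    have r := Symbol.four_mul_rank_of_odd hodd (N := N + 1) (by omega) (by omega)
    have r' := Symbol.four_mul_rank_of_even hd' (N := N + 1) (by omega) (by omega)
    have htail : ∑ i ∈ Finset.range (N + 1), (upsFun Λ.B i : ℤ)
        = ∑ i ∈ Finset.range (N + 1), (tailPart (upsFun Λ.B) i : ℤ) + upsFun Λ.B 0 := by
      have hlast : tailPart (upsFun Λ.B) N = 0 := upsFun_eq_zero (by omega)
      rw [Finset.sum_range_succ', Finset.sum_range_succ (fun i => (tailPart (upsFun Λ.B) i : ℤ)),
        hlast]
      simp [tailPart]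
    rw [h1, h2, h3] at r'
    obtain ⟨t, ht⟩ := hodd
    have hhalf : (Λ.defect + 1) / 2 = t + 1 := by omega
    rw [hhalf] at hn'
    rw [ht] at r r'
    have hfour : 4 * Λ'.rank = 4 * (n' : ℤ) := by
      rw [hn', ← hn]
      linear_combination r' - r - 4 * htail
    omega
  · rintro Λ'' ⟨hr, -, hP, hQ, hd⟩
    rw [or_iff_not_imp_right, not_lt]
    intro hle
    have hdef : Λ''.defect = Λ.defect := by omega
    have hA : ∀ i, upsFun Λ''.A i ≤ upsFun Λ.A i := fun i => by
      rw [← h2]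
      exact (hQ.interlace (isPartitionFun_upsFun _) (isPartitionFun_upsFun _) i).1
    have hB : ∀ i, upsFun Λ''.B i ≤ upsFun Λ.B i := by
      rintro (_ | i)
      · exact hle
      · have := (hP.interlace (isPartitionFun_upsFun _) (isPartitionFun_upsFun _) i).2
        rwa [h1] at this
    have hsum : ∀ N, Λ.A.card ≤ N → Λ.B.card ≤ N → Λ''.A.card ≤ N → Λ''.B.card ≤ N →
        ∀ i ∈ Finset.range N, upsFun Λ''.A i = upsFun Λ.A i ∧ upsFun Λ''.B i = upsFun Λ.B i := by
      intro N hN₁ hN₂ hN₃ hN₄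
      have r := Symbol.four_mul_rank_of_odd hodd hN₁ hN₂
      have r'' := Symbol.four_mul_rank_of_odd (hdef ▸ hodd) hN₃ hN₄
      rw [hn] at r
      rw [hr, hdef] at r''
      have heq : ∑ i ∈ Finset.range N, (upsFun Λ''.A i + upsFun Λ''.B i)
          = ∑ i ∈ Finset.range N, (upsFun Λ.A i + upsFun Λ.B i) := by
        zify
        rw [Finset.sum_add_distrib, Finset.sum_add_distrib]
        linarith
      intro i hi
      have := (Finset.sum_eq_sum_iff_of_le fun i _ => add_le_add (hA i) (hB i)).mp heq i hi
      have := hA i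
      have := hB i
      omega
    have hall : ∀ i, upsFun Λ''.A i = upsFun Λ.A i ∧ upsFun Λ''.B i = upsFun Λ.B i := fun i =>
      hsum (Λ.A.card + Λ.B.card + Λ''.A.card + Λ''.B.card + i + 1) (by omega) (by omega)
        (by omega) (by omega) i (by simp only [Finset.mem_range]; omega)
    have eA : upsFun Λ''.A = upsFun Λ.A := funext fun i => (hall i).1
    have eB : upsFun Λ''.B = upsFun Λ.B := funext fun i => (hall i).2
    exact ⟨eA, eB, Symbol.equiv_of_upsFun_eq hdef eA eB⟩

end GGP
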